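/- For every p > 2 and every t ∈ (0,∞) with t ≠ 1, one has g(t) < 0. -/

import Mathlib

/-- `f(t) = t²/2 - tᵖ/p`. -/
noncomputable def f (p t : ℝ) : ℝ := t ^ 2 / 2 - t ^ p / p

/-- First derivative: `f'(t) = t - t^(p-1)`. -/
noncomputable def f' (p t : ℝ) : ℝ := t - t ^ (p - 1)

/-- Second derivative: `f''(t) = 1 - (p-1) t^(p-2)`. -/
noncomputable def f'' (p t : ℝ) : ℝ := 1 - (p - 1) * t ^ (p - 2)

/-- Third derivative: `f'''(t) = -(p-1)(p-2) t^(p-3)`. -/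
noncomputable def f''' (p t : ℝ) : ℝ := -(p - 1) * (p - 2) * t ^ (p - 3)

/-- `g(t) = -3 f''(t) f'(t)² + 6 (f(t)-f(1)) f''(t)² - 2 (f(t)-f(1)) f'''(t) f'(t)`. -/
noncomputable def g (p t : ℝ) : ℝ :=
  -3 * f'' p t * (f' p t) ^ 2 + 6 * (f p t - f p 1) * (f'' p t) ^ 2
    - 2 * (f p t - f p 1) * f''' p t * f' p t

/-- The fourth derivative of `f p`. -/
noncomputable def fourthDeriv (p t : ℝ) : ℝ := -(p - 1) * (p - 2) * (p - 3) * t ^ (p - 4)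

theorem hasDerivAt_f {p t : ℝ} (hp : p ≠ 0) (ht : 0 < t) : HasDerivAt (f p) (f' p t) t := by
  have h := (((hasDerivAt_id t).pow 2).div_const 2).sub
    ((Real.hasDerivAt_rpow_const (p := p) (Or.inl ht.ne')).div_const p)
  refine h.congr_deriv ?_
  simp only [f', id]
  field_simp
  ring

theorem hasDerivAt_f' {p t : ℝ} (ht : 0 < t) : HasDerivAt (f' p) (f'' p t) t := by
  have h := (hasDerivAt_id t).sub (Real.hasDerivAt_rpow_const (p := p - 1) (Or.inl ht.ne'))
  refine h.congr_deriv ?_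
  rw [f'', show p - 1 - 1 = p - 2 by ring]

theorem hasDerivAt_f'' {p t : ℝ} (ht : 0 < t) : HasDerivAt (f'' p) (f''' p t) t := by
  have h := ((Real.hasDerivAt_rpow_const (p := p - 2) (Or.inl ht.ne')).const_mul
    (p - 1)).const_sub 1
  refine h.congr_deriv ?_
  rw [f''', show p - 2 - 1 = p - 3 by ring]
  ring

theorem hasDerivAt_f''' {p t : ℝ} (ht : 0 < t) : HasDerivAt (f''' p) (fourthDeriv p t) t := by
  have h := (Real.hasDerivAt_rpow_const (p := p - 3) (Or.inl ht.ne')).const_mul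
    (-(p - 1) * (p - 2))
  refine h.congr_deriv ?_
  rw [fourthDeriv, show p - 3 - 1 = p - 4 by ring]
  ring

theorem f'_eq {p t : ℝ} (ht : 0 < t) : f' p t = t * (1 - t ^ (p - 2)) := by
  rw [f', show p - 1 = p - 2 + 1 by ring, Real.rpow_add_one ht.ne']
  ring

theorem f'''_eq {p t : ℝ} (ht : 0 < t) :
    f''' p t = -(p - 1) * (p - 2) * t ^ (p - 2) / t := by
  rw [f''', show p - 3 = p - 2 - 1 by ring, Real.rpow_sub_one ht.ne']
  ring

theorem fourthDeriv_eq {p t : ℝ} (ht : 0 < t) :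
    fourthDeriv p t = -(p - 1) * (p - 2) * (p - 3) * t ^ (p - 2) / t ^ 2 := by
  rw [fourthDeriv, show p - 4 = p - 2 - (2 : ℕ) by norm_num; ring, Real.rpow_sub_natCast ht.ne']
  ring

/-- The maximum of `f p` is attained only at `1`. -/
theorem f_lt_f_one {p t : ℝ} (hp : 2 < p) (ht : 0 < t) (ht1 : t ≠ 1) : f p t < f p 1 := by
  have h := one_add_mul_self_lt_rpow_one_add (s := t ^ 2 - 1) (p := p / 2)
    (by nlinarith [sq_nonneg t])
    (fun h => ht1 (by nlinarith [show (t - 1) * (t + 1) = 0 by linarith])) (by linarith)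
  have h2 : (1 + (t ^ 2 - 1)) ^ (p / 2) = t ^ p := by
    rw [add_sub_cancel, ← Real.rpow_natCast, ← Real.rpow_mul ht.le]
    congr 1
    push_cast
    ring
  rw [h2] at h
  have hp0 : 0 < p := by linarith
  have h3 : (1 + p / 2 * (t ^ 2 - 1)) / p < t ^ p / p := by gcongr
  have h4 : (1 + p / 2 * (t ^ 2 - 1)) / p = 1 / p + (t ^ 2 - 1) / 2 := by field_simp
  simp only [f, Real.one_rpow, one_pow]
  linarith

/-- The coefficient of `f p t - f p 1` in `g p t`. -/
noncomputable def gCoeff (p t : ℝ) : ℝ := 6 * f'' p t ^ 2 - 2 * f''' p t * f' p t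

theorem gCoeff_pos {p t : ℝ} (hp : 2 < p) (ht : 0 < t) : 0 < gCoeff p t := by
  have hs : 0 < t ^ (p - 2) := by positivity
  have h : gCoeff p t = 6 * (1 - (p - 1) * t ^ (p - 2)) ^ 2
      + 2 * (p - 1) * (p - 2) * t ^ (p - 2) * (1 - t ^ (p - 2)) := by
    rw [gCoeff, f'_eq ht, f'''_eq ht, f'']
    field_simp
    ring
  rw [h]
  generalize t ^ (p - 2) = s at hs
  obtain ⟨q, rfl⟩ : ∃ q, p = q + 2 := ⟨p - 2, by ring⟩
  have hq : 0 < q := by linarith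
  have h' : 6 * (1 - (q + 2 - 1) * s) ^ 2 + 2 * (q + 2 - 1) * (q + 2 - 2) * s * (1 - s)
      = 6 + (q + 1) * ((2 * q - 12) * s + (4 * q + 6) * s ^ 2) := by ring
  rw [h']
  rcases le_or_gt 6 q with h6 | h6
  · have : 0 ≤ 2 * q - 12 := by linarith
    positivity
  · have hd : 0 < q ^ 2 * (11 - q) := mul_pos (by positivity) (by linarith)
    have key : 0 < (4 * (4 * q + 6)) *
        (6 + (q + 1) * ((2 * q - 12) * s + (4 * q + 6) * s ^ 2)) := by
      have : (4 * (4 * q + 6)) * (6 + (q + 1) * ((2 * q - 12) * s + (4 * q + 6) * s ^ 2))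
        = (q + 1) * (2 * (4 * q + 6) * s + (2 * q - 12)) ^ 2 + 4 * (q ^ 2 * (11 - q)) := by ring
      rw [this]
      positivity
    exact pos_of_mul_pos_right key (by positivity)

/-- The quotient of `g p` by the positive factor `gCoeff p`. -/
noncomputable def gQuot (p t : ℝ) : ℝ := f p t - f p 1 - 3 * f'' p t * f' p t ^ 2 / gCoeff p t

theorem g_eq_gCoeff_mul_gQuot {p t : ℝ} (hp : 2 < p) (ht : 0 < t) :
    g p t = gCoeff p t * gQuot p t := by
  rw [gQuot, mul_sub, mul_div_cancel₀ _ (gCoeff_pos hp ht).ne', gCoeff, g]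
  ring

theorem gQuot_one (p : ℝ) : gQuot p 1 = 0 := by
  simp [gQuot, f']

theorem hasDerivAt_gQuot {p t : ℝ} (hp : 2 < p) (ht : 0 < t) :
    HasDerivAt (gQuot p)
      (f' p t ^ 3 * (10 * f''' p t ^ 2 - 6 * f'' p t * fourthDeriv p t) / gCoeff p t ^ 2) t := by
  have h0 := hasDerivAt_f (p := p) (by linarith) ht
  have h1 := hasDerivAt_f' (p := p) ht
  have h2 := hasDerivAt_f'' (p := p) ht
  have h3 := hasDerivAt_f''' (p := p) ht
  have hB : HasDerivAt (gCoeff p) _ t :=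
    ((h2.pow 2).const_mul 6).sub ((h3.const_mul 2).mul h1)
  have hB0 := (gCoeff_pos hp ht).ne'
  have h := (h0.sub_const (f p 1)).sub (((h2.const_mul 3).mul (h1.pow 2)).div hB hB0)
  refine h.congr_deriv ?_
  simp only [Pi.mul_apply, Pi.pow_apply]
  field_simp
  rw [gCoeff]
  push_cast
  ring

/-- Positivity of the factor governing the sign of the derivative of `gQuot p`. -/
theorem deriv_factor_pos {p t : ℝ} (hp : 2 < p) (ht : 0 < t) (hs : 1 ≤ (p - 1) * t ^ (p - 2)) :
    0 < 10 * f''' p t ^ 2 - 6 * f'' p t * fourthDeriv p t := by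
  have hs0 : 0 < t ^ (p - 2) := by positivity
  have h : 10 * f''' p t ^ 2 - 6 * f'' p t * fourthDeriv p t =
      (p - 1) * (p - 2) * t ^ (p - 2) / t ^ 2 *
        ((4 * (p - 2) + 6) * ((p - 1) * t ^ (p - 2)) + 6 * (p - 3)) := by
    rw [f'''_eq ht, fourthDeriv_eq ht, f'']
    field_simp
    ring
  rw [h]
  have h1 : 0 < p - 1 := by linarith
  have h2 : 0 < p - 2 := by linarith
  refine mul_pos (by positivity) ?_
  nlinarith

theorem gQuot_neg_of_lt_one {p t : ℝ} (hp : 2 < p) (ht : 0 < t) (ht1 : t < 1)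
    (hs : 1 ≤ (p - 1) * t ^ (p - 2)) : gQuot p t < 0 := by
  have hmono : StrictMonoOn (gQuot p) (Set.Icc t 1) := by
    refine strictMonoOn_of_deriv_pos (convex_Icc _ _)
      (fun u hu => (hasDerivAt_gQuot hp (ht.trans_le hu.1)).continuousAt.continuousWithinAt)
      fun u hu => ?_
    rw [interior_Icc] at hu
    have hu0 : 0 < u := ht.trans hu.1
    rw [(hasDerivAt_gQuot hp hu0).deriv]
    have hB := gCoeff_pos hp hu0
    have hle : t ^ (p - 2) ≤ u ^ (p - 2) := Real.rpow_le_rpow ht.le hu.1.le (by linarith)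
    have hK := deriv_factor_pos hp hu0 (hs.trans (by gcongr; linarith))
    have hf' : 0 < f' p u := by
      rw [f'_eq hu0]
      exact mul_pos hu0 (sub_pos.2 (Real.rpow_lt_one hu0.le hu.2 (by linarith)))
    positivity
  simpa [gQuot_one] using hmono (Set.left_mem_Icc.2 ht1.le) (Set.right_mem_Icc.2 ht1.le) ht1

theorem gQuot_neg_of_one_lt {p t : ℝ} (hp : 2 < p) (ht1 : 1 < t) : gQuot p t < 0 := by
  have hanti : StrictAntiOn (gQuot p) (Set.Ici 1) := by
    refine strictAntiOn_of_deriv_neg (convex_Ici _)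
      (fun u hu => (hasDerivAt_gQuot hp
        (one_pos.trans_le (Set.mem_Ici.1 hu))).continuousAt.continuousWithinAt)
      fun u hu => ?_
    rw [interior_Ici, Set.mem_Ioi] at hu
    have hu0 : 0 < u := one_pos.trans hu
    rw [(hasDerivAt_gQuot hp hu0).deriv]
    have hs : 1 < u ^ (p - 2) := Real.one_lt_rpow hu (by linarith)
    have hK := deriv_factor_pos hp hu0 (by nlinarith)
    have hf' : f' p u < 0 := by
      rw [f'_eq hu0]
      exact mul_neg_of_pos_of_neg hu0 (by linarith)
    exact div_neg_of_neg_of_pos (mul_neg_of_neg_of_pos (Odd.pow_neg (by decide) hf') hK)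
      (pow_pos (gCoeff_pos hp hu0) 2)
  simpa [gQuot_one] using hanti Set.self_mem_Ici (Set.mem_Ici.2 ht1.le) ht1

/-- for every `p > 2` and every `t ∈ (0,∞)` with `t ≠ 1`, `g(t) < 0`. -/
theorem stmt_9 (p : ℝ) (hp : 2 < p) (t : ℝ) (ht : 0 < t) (ht1 : t ≠ 1) :
    g p t < 0 := by
  have hB := gCoeff_pos hp ht
  rw [g_eq_gCoeff_mul_gQuot hp ht]
  refine mul_neg_of_pos_of_neg hB ?_
  rcases ht1.lt_or_gt with hlt | hgt
  · rcases le_or_gt 1 ((p - 1) * t ^ (p - 2)) with hs | hs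
    · exact gQuot_neg_of_lt_one hp ht hlt hs
    · have hf'' : 0 < f'' p t := sub_pos.2 hs
      have : 0 ≤ 3 * f'' p t * f' p t ^ 2 / gCoeff p t := by positivity
      have := f_lt_f_one hp ht ht1
      rw [gQuot]
      linarith
  · exact gQuot_neg_of_one_lt hp hgt
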